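/- There exists an absolute constant C > 0 such that for every ε ∈ (0, 1] the following holds. Let R = [x₀, x₀+1] × [y₀, y₀ + 2ε^{−1/2}] be an axis-parallel rectangle of width 1 and height 2ε^{−1/2}. Let L₁ and L₂ be y-monotone rectilinear polygonal paths contained in the vertical strip {(x,y) : x₀ ≤ x ≤ x₀+1}, each with horizontal edges of total length at most 1, such that the lowest point of L₁ lies on the top side of R (so L₁ lies in the half-plane y ≥ y₀ + 2ε^{−1/2}) and the highest point of L₂ lies on the bottom side of R (so L₂ lies in the half-plane y ≤ y₀). Then there exists a geometric graph E comprised of the edges of L₁ and L₂ together with additional segments of total weight at most C · ε^{−1/2}, such that for every a ∈ L₁ and every b ∈ L₂ there is an ab-path P in E with weight ‖P‖ ≤ (1 + C·ε)·‖a − b‖. -/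

import Mathlib

open scoped Classical

noncomputable section

/-- The Euclidean plane. -/
abbrev Plane : Type := EuclideanSpace ℝ (Fin 2)

/-- The point `(x, y) ∈ ℝ²`. -/
def pt (x y : ℝ) : Plane := (EuclideanSpace.equiv (Fin 2) ℝ).symm ![x, y]

/-- The union of the segments of a geometric graph. -/
def segUnion (E : Finset (Plane × Plane)) : Set Plane :=
  ⋃ e ∈ E, segment ℝ e.1 e.2

/-- The total weight of a geometric graph: the sum of the Euclidean lengths of its
segments. -/
def gweight (E : Finset (Plane × Plane)) : ℝ :=
  ∑ e ∈ E, ‖e.1 - e.2‖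

/-- `HasPath E s t w` : there is a polygonal path from `s` to `t`, each of whose edges is
contained in the union of the segments of `E`, of weight at most `w`. -/
def HasPath (E : Finset (Plane × Plane)) (s t : Plane) (w : ℝ) : Prop :=
  ∃ (m : ℕ) (v : ℕ → Plane), v 0 = s ∧ v m = t ∧
    (∀ i < m, segment ℝ (v i) (v (i + 1)) ⊆ segUnion E) ∧
    ∑ i ∈ Finset.range m, ‖v (i + 1) - v i‖ ≤ w

/-- A rectilinear path: every edge is horizontal or vertical. -/
def IsRectilinear (n : ℕ) (u : ℕ → Plane) : Prop :=
  ∀ i < n, u i 0 = u (i + 1) 0 ∨ u i 1 = u (i + 1) 1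

/-- The set of points of the polygonal path with vertices `u 0, …, u n`. -/
def pathSet (n : ℕ) (u : ℕ → Plane) : Set Plane :=
  ⋃ i ∈ Finset.range n, segment ℝ (u i) (u (i + 1))

/-- The edges of the polygonal path with vertices `u 0, …, u n`, as a geometric graph. -/
def pathEdges (n : ℕ) (u : ℕ → Plane) : Finset (Plane × Plane) :=
  (Finset.range n).image fun i => (u i, u (i + 1))

/-- A `y`-monotone path: the `y`-coordinates of the vertices are monotone along the
path (nondecreasing or nonincreasing). -/
def IsYMonotone (n : ℕ) (u : ℕ → Plane) : Prop :=
  (∀ i < n, u i 1 ≤ u (i + 1) 1) ∨ (∀ i < n, u (i + 1) 1 ≤ u i 1)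

/-- The total length of the horizontal edges of a rectilinear path. -/
def hper (n : ℕ) (u : ℕ → Plane) : ℝ :=
  ∑ i ∈ Finset.range n, |u (i + 1) 0 - u i 0|

/-! ### Points of the plane -/

@[simp] theorem pt_zero (x y : ℝ) : pt x y 0 = x := by simp [pt]

@[simp] theorem pt_one (x y : ℝ) : pt x y 1 = y := by simp [pt]

theorem plane_ext {p q : Plane} (h0 : p 0 = q 0) (h1 : p 1 = q 1) : p = q := by
  ext i
  fin_cases i
  · exact h0
  · exact h1

@[simp] theorem pt_eta (p : Plane) : pt (p 0) (p 1) = p := plane_ext (by simp) (by simp)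

theorem norm_plane (p : Plane) : ‖p‖ = √(p 0 ^ 2 + p 1 ^ 2) := by
  simp [EuclideanSpace.norm_eq]

theorem norm_le_abs_add_abs (p : Plane) : ‖p‖ ≤ |p 0| + |p 1| := by
  rw [norm_plane]
  refine Real.sqrt_le_iff.2 ⟨by positivity, ?_⟩
  nlinarith [sq_abs (p 0), sq_abs (p 1), abs_nonneg (p 0), abs_nonneg (p 1),
    mul_nonneg (abs_nonneg (p 0)) (abs_nonneg (p 1))]

theorem apply_one_le_norm (p : Plane) : p 1 ≤ ‖p‖ := by
  rw [norm_plane]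
  exact Real.le_sqrt_of_sq_le (by nlinarith [sq_nonneg (p 0)])

/-- A segment of slope at least `c` exceeds its height by a lower order term. -/
theorem norm_le_of_steep {p : Plane} {c d : ℝ} (hc : 0 < c) (hd : 0 ≤ d) (h0 : |p 0| ≤ 2 * d)
    (h1 : p 1 = c * d) : ‖p‖ ≤ c * d + 2 * d / c := by
  rw [norm_plane, h1]
  refine Real.sqrt_le_iff.2 ⟨by positivity, ?_⟩
  have h2 : p 0 ^ 2 ≤ (2 * d) ^ 2 := sq_le_sq' (abs_le.1 h0).1 (abs_le.1 h0).2
  have h3 : (c * d + 2 * d / c) ^ 2 = (c * d) ^ 2 + (2 * d) ^ 2 + (2 * d / c) ^ 2 := by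
    field_simp
    ring
  rw [h3]
  nlinarith [sq_nonneg (2 * d / c)]

theorem pt_mem_vertical_segment {x a b y : ℝ} (h1 : a ≤ y) (h2 : y ≤ b) :
    pt x y ∈ segment ℝ (pt x a) (pt x b) := by
  rcases eq_or_lt_of_le (h1.trans h2) with h | h
  · obtain rfl : y = a := by linarith
    exact left_mem_segment ℝ _ _
  · have hba : 0 < b - a := by linarith
    refine ⟨(b - y) / (b - a), (y - a) / (b - a), div_nonneg (by linarith) hba.le,
      div_nonneg (by linarith) hba.le, by field_simp; ring, plane_ext ?_ ?_⟩
    · simp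
      field_simp
      ring
    · simp
      field_simp
      ring

/-! ### Polygonal paths in geometric graphs -/

theorem segment_subset_segUnion {E : Finset (Plane × Plane)} {e : Plane × Plane} (he : e ∈ E) :
    segment ℝ e.1 e.2 ⊆ segUnion E :=
  Set.subset_biUnion_of_mem (u := fun e : Plane × Plane => segment ℝ e.1 e.2) he

theorem segUnion_union (E F : Finset (Plane × Plane)) :
    segUnion (E ∪ F) = segUnion E ∪ segUnion F := by
  ext p
  simp [segUnion, or_and_right, exists_or]

theorem segUnion_pathEdges (n : ℕ) (u : ℕ → Plane) : segUnion (pathEdges n u) = pathSet n u := by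
  ext p
  simp [segUnion, pathEdges, pathSet]

theorem segment_subset_pathSet {n i : ℕ} (u : ℕ → Plane) (hi : i < n) :
    segment ℝ (u i) (u (i + 1)) ⊆ pathSet n u :=
  Set.subset_biUnion_of_mem (u := fun i => segment ℝ (u i) (u (i + 1))) (Finset.mem_range.2 hi)

theorem vertex_mem_pathSet {n i : ℕ} (u : ℕ → Plane) (hn : 0 < n) (hi : i ≤ n) :
    u i ∈ pathSet n u := by
  rcases hi.lt_or_eq with h | rfl
  · exact segment_subset_pathSet u h (left_mem_segment ℝ _ _)
  · obtain ⟨j, rfl⟩ := Nat.exists_eq_succ_of_ne_zero hn.ne'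
    exact segment_subset_pathSet u (Nat.lt_succ_self j) (right_mem_segment ℝ _ _)

theorem gweight_union_le (E F : Finset (Plane × Plane)) :
    gweight (E ∪ F) ≤ gweight E + gweight F := by
  unfold gweight
  rw [← Finset.sum_union_inter]
  exact le_add_of_nonneg_right (Finset.sum_nonneg fun _ _ => norm_nonneg _)

theorem gweight_image_le {ι : Type*} (s : Finset ι) (f : ι → Plane × Plane) :
    gweight (s.image f) ≤ ∑ i ∈ s, ‖(f i).1 - (f i).2‖ :=
  Finset.sum_image_le_of_nonneg (f := fun e : Plane × Plane => ‖e.1 - e.2‖)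
    fun _ _ => norm_nonneg _

namespace HasPath

variable {E F : Finset (Plane × Plane)} {p q r : Plane} {w w' : ℝ}

theorem mono (h : HasPath E p q w) (hEF : segUnion E ⊆ segUnion F) (hw : w ≤ w') :
    HasPath F p q w' := by
  obtain ⟨m, v, h0, hm, hs, hl⟩ := h
  exact ⟨m, v, h0, hm, fun i hi => (hs i hi).trans hEF, hl.trans hw⟩

theorem rfl' (E : Finset (Plane × Plane)) (p : Plane) : HasPath E p p 0 :=
  ⟨0, fun _ => p, rfl, rfl, by simp, by simp⟩

theorem cons (hpq : segment ℝ p q ⊆ segUnion E) (h : HasPath E q r w) :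
    HasPath E p r (‖q - p‖ + w) := by
  obtain ⟨m, v, h0, hm, hs, hl⟩ := h
  refine ⟨m + 1, fun i => Nat.casesOn i p v, rfl, hm, ?_, ?_⟩
  · rintro (_ | i) hi
    · simpa [h0] using hpq
    · exact hs i (by omega)
  · rw [Finset.sum_range_succ']
    change _ + ‖v 0 - p‖ ≤ _
    rw [h0]
    linarith

theorem of_segment (hpq : segment ℝ p q ⊆ segUnion E) : HasPath E p q ‖q - p‖ := by
  simpa using cons hpq (rfl' E q)

theorem trans (h : HasPath E p q w) (h' : HasPath E q r w') : HasPath E p r (w + w') := by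
  obtain ⟨m, v, h0, hm, hs, hl⟩ := h
  induction m generalizing v p w with
  | zero =>
    subst h0
    rw [← hm] at h'
    exact h'.mono subset_rfl (by simpa using hl)
  | succ m ih =>
    rw [Finset.sum_range_succ'] at hl
    have h1 := ih (p := v 1) (w := w - ‖v 1 - v 0‖) (fun i => v (i + 1)) rfl hm
      (fun i hi => hs (i + 1) (by omega)) (by simp only [zero_add] at hl; linarith)
    have h2 := cons (hs 0 (by omega)) h1
    rw [h0] at h2
    exact h2.mono subset_rfl (by linarith)

theorem symm (h : HasPath E p q w) : HasPath E q p w := by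
  obtain ⟨m, v, h0, hm, hs, hl⟩ := h
  refine ⟨m, fun i => v (m - i), by simpa using hm, by simpa using h0, fun i hi => ?_, ?_⟩
  · have := hs (m - (i + 1)) (by omega)
    rw [show m - (i + 1) + 1 = m - i by omega] at this
    rwa [segment_symm]
  · refine le_trans (le_of_eq ?_) hl
    rw [← Finset.sum_range_reflect]
    refine Finset.sum_congr rfl fun i hi => ?_
    have hi := Finset.mem_range.1 hi
    beta_reduce
    rw [norm_sub_rev, show m - 1 - i + 1 = m - i by omega, show m - (m - i) = i by omega,
      show m - (m - 1 - i) = i + 1 by omega]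

theorem neg (h : HasPath E p q w) (hEF : ∀ z ∈ segUnion E, -z ∈ segUnion F) :
    HasPath F (-p) (-q) w := by
  obtain ⟨m, v, h0, hm, hs, hl⟩ := h
  refine ⟨m, fun i => -v i, by simp [h0], by simp [hm], fun i hi z hz => ?_, ?_⟩
  · obtain ⟨a, b, ha, hb, hab, rfl⟩ := hz
    have := hEF _ (hs i hi ⟨a, b, ha, hb, hab, rfl⟩)
    convert this using 1
    module
  · refine le_trans (le_of_eq ?_) hl
    refine Finset.sum_congr rfl fun i _ => ?_
    rw [← norm_neg]
    congr 1
    module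

end HasPath

/-- There is a path from `p` to `q` whose weight exceeds the height difference by at most `e`. -/
def Climb (E : Finset (Plane × Plane)) (p q : Plane) (e : ℝ) : Prop :=
  HasPath E p q (q 1 - p 1 + e)

namespace Climb

variable {E : Finset (Plane × Plane)} {p q r : Plane} {e e' : ℝ}

theorem mono (h : Climb E p q e) (he : e ≤ e') : Climb E p q e' :=
  HasPath.mono h subset_rfl (by linarith)

theorem trans (h : Climb E p q e) (h' : Climb E q r e') : Climb E p r (e + e') :=
  (HasPath.trans h h').mono subset_rfl (by linarith)

theorem rfl' (E : Finset (Plane × Plane)) (p : Plane) : Climb E p p 0 := by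
  simpa [Climb] using HasPath.rfl' E p

theorem of_segment (hs : segment ℝ p q ⊆ segUnion E) (hw : ‖q - p‖ ≤ q 1 - p 1 + e) :
    Climb E p q e :=
  (HasPath.of_segment hs).mono subset_rfl hw

theorem of_vertical {x a b y z : ℝ} (hs : segment ℝ (pt x a) (pt x b) ⊆ segUnion E)
    (hay : a ≤ y) (hyz : y ≤ z) (hzb : z ≤ b) : Climb E (pt x y) (pt x z) 0 := by
  refine of_segment (((convex_segment _ _).segment_subset (pt_mem_vertical_segment hay ?_)
    (pt_mem_vertical_segment ?_ hzb)).trans hs) ?_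
  · linarith
  · linarith
  · refine (norm_le_abs_add_abs _).trans ?_
    simp [abs_of_nonneg (sub_nonneg.2 hyz)]

/-- Walking along a segment that does not descend. -/
theorem of_ascending (hs : segment ℝ p q ⊆ segUnion E) (h : p 1 ≤ q 1) :
    Climb E p q |q 0 - p 0| := by
  refine of_segment hs ((norm_le_abs_add_abs _).trans ?_)
  simp [abs_of_nonneg (sub_nonneg.2 h), add_comm]

end Climb

/-! ### Dyadic blocks and lower envelopes of prescribed slope -/

/-- The index of the dyadic block of width `2⁻ᵏ` that contains `t i`. -/
def blockIndex (t : ℕ → ℝ) (k i : ℕ) : ℕ := ⌊2 ^ k * t i⌋₊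

/-- The first index in a dyadic block. -/
def blockStart (t : ℕ → ℝ) (k b : ℕ) : ℕ := sInf {i | blockIndex t k i = b}

/-- Within each dyadic block of width `2⁻ᵏ`, the largest function below `D` that grows with slope
at least `c` with respect to `t`. -/
def envelope (t D : ℕ → ℝ) (n k : ℕ) (c : ℝ) (i : ℕ) : ℝ :=
  (insert i ((Finset.Icc i n).filter fun j => blockIndex t k j = blockIndex t k i)).inf'
    (Finset.insert_nonempty _ _) fun j => D j - c * (t j - t i)

section Blocks

variable {t D : ℕ → ℝ} {n k i j : ℕ} {c c' : ℝ}

theorem blockIndex_mono (ht : Monotone t) (k : ℕ) : Monotone (blockIndex t k) := fun i j hij =>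
  Nat.floor_le_floor (mul_le_mul_of_nonneg_left (ht hij) (by positivity))

theorem blockIndex_div_two (t : ℕ → ℝ) (k i : ℕ) :
    blockIndex t (k + 1) i / 2 = blockIndex t k i := by
  unfold blockIndex
  rw [← Nat.floor_div_natCast]
  congr 1
  push_cast
  ring

theorem blockIndex_eq_of_succ (h : blockIndex t (k + 1) i = blockIndex t (k + 1) j) :
    blockIndex t k i = blockIndex t k j := by
  rw [← blockIndex_div_two, h, blockIndex_div_two]

theorem sub_le_of_blockIndex_eq (ht0 : ∀ i, 0 ≤ t i) (h : blockIndex t k i = blockIndex t k j) :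
    t j - t i ≤ (1 / 2) ^ k := by
  have h1 : 2 ^ k * t j < blockIndex t k j + 1 := Nat.lt_floor_add_one _
  have h2 : (blockIndex t k i : ℝ) ≤ 2 ^ k * t i :=
    Nat.floor_le (mul_nonneg (by positivity) (ht0 i))
  rw [h] at h2
  rw [one_div, inv_pow, ← one_div, le_div_iff₀ (by positivity)]
  linarith

theorem blockIndex_lt (ht0 : ∀ i, 0 ≤ t i) (h : t i < 1) : blockIndex t k i < 2 ^ k := by
  refine (Nat.floor_lt (mul_nonneg (by positivity) (ht0 i))).2 ?_
  push_cast
  exact mul_lt_of_lt_one_right (by positivity) h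

theorem blockIndex_blockStart (t : ℕ → ℝ) (k i : ℕ) :
    blockIndex t k (blockStart t k (blockIndex t k i)) = blockIndex t k i :=
  Nat.sInf_mem (s := {j | blockIndex t k j = blockIndex t k i}) ⟨i, rfl⟩

theorem blockStart_le (h : blockIndex t k j = blockIndex t k i) :
    blockStart t k (blockIndex t k i) ≤ j :=
  Nat.sInf_le h

theorem blockStart_le_succ (t : ℕ → ℝ) (k i : ℕ) :
    blockStart t k (blockIndex t k i) ≤ blockStart t (k + 1) (blockIndex t (k + 1) i) :=
  blockStart_le (blockIndex_eq_of_succ (blockIndex_blockStart t (k + 1) i))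

theorem envelope_le (h1 : i ≤ j) (h2 : j ≤ n) (h3 : blockIndex t k j = blockIndex t k i) :
    envelope t D n k c i ≤ D j - c * (t j - t i) :=
  Finset.inf'_le (fun j => D j - c * (t j - t i)) (by simp [h1, h2, h3])

theorem envelope_le_self : envelope t D n k c i ≤ D i := by
  simp [envelope]

theorem exists_envelope_eq (hi : i ≤ n) : ∃ j, i ≤ j ∧ j ≤ n ∧
    blockIndex t k j = blockIndex t k i ∧ envelope t D n k c i = D j - c * (t j - t i) := by
  obtain ⟨j, hj, he⟩ := Finset.exists_mem_eq_inf' (Finset.insert_nonempty i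
    ((Finset.Icc i n).filter fun j => blockIndex t k j = blockIndex t k i))
    (fun j => D j - c * (t j - t i))
  simp only [Finset.mem_insert, Finset.mem_filter, Finset.mem_Icc] at hj
  rcases hj with rfl | hj
  · exact ⟨j, le_rfl, hi, rfl, he⟩
  · exact ⟨j, hj.1.1, hj.1.2, hj.2, he⟩

theorem le_envelope (ht0 : ∀ i, 0 ≤ t i) (hD : ∀ i j, i ≤ j → j ≤ n → D i ≤ D j) (hc : 0 ≤ c)
    (hi : i ≤ n) : D i - c * (1 / 2) ^ k ≤ envelope t D n k c i := by
  obtain ⟨j, h1, h2, h3, h4⟩ := exists_envelope_eq (t := t) (D := D) (k := k) (c := c) hi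
  rw [h4]
  have := hD i j h1 h2
  have := mul_le_mul_of_nonneg_left (sub_le_of_blockIndex_eq ht0 h3.symm) hc
  linarith

theorem envelope_step (hi : i < n) (h : blockIndex t k (i + 1) = blockIndex t k i) :
    envelope t D n k c i ≤ envelope t D n k c (i + 1) - c * (t (i + 1) - t i) ∧
    (envelope t D n k c i = envelope t D n k c (i + 1) - c * (t (i + 1) - t i) ∨
      envelope t D n k c i = D i) := by
  have hle : envelope t D n k c i ≤ envelope t D n k c (i + 1) - c * (t (i + 1) - t i) := by
    obtain ⟨j, h1, h2, h3, h4⟩ :=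
      exists_envelope_eq (t := t) (D := D) (k := k) (c := c) (Nat.succ_le_of_lt hi)
    have := envelope_le (t := t) (D := D) (c := c) (by omega : i ≤ j) h2 (h3.trans h)
    rw [h4]
    linarith
  refine ⟨hle, ?_⟩
  obtain ⟨j, h1, h2, h3, h4⟩ := exists_envelope_eq (t := t) (D := D) (k := k) (c := c) hi.le
  rcases h1.eq_or_lt with rfl | h1
  · right
    simpa using h4
  · left
    have := envelope_le (t := t) (D := D) (c := c) (Nat.succ_le_of_lt h1) h2 (h3.trans h.symm)
    linarith

theorem envelope_le_succ (ht : Monotone t) (hc : c' ≤ c) (hi : i ≤ n) :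
    envelope t D n k c i ≤ envelope t D n (k + 1) c' i := by
  obtain ⟨j, h1, h2, h3, h4⟩ := exists_envelope_eq (t := t) (D := D) (k := k + 1) (c := c') hi
  rw [h4]
  refine (envelope_le h1 h2 (blockIndex_eq_of_succ h3)).trans ?_
  have := mul_le_mul_of_nonneg_right hc (sub_nonneg.2 (ht h1))
  linarith

end Blocks

/-! ### The hierarchy of spines below an ascending path -/

theorem hper_succ (n : ℕ) (u : ℕ → Plane) :
    hper (n + 1) u = hper n u + |u (n + 1) 0 - u n 0| :=
  Finset.sum_range_succ _ _

theorem hper_monotone (u : ℕ → Plane) : Monotone fun n => hper n u :=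
  monotone_nat_of_le_succ fun n => by
    rw [hper_succ]
    exact le_add_of_nonneg_right (abs_nonneg _)

/-- Half of the horizontal length of the initial part of a path. -/
def halfPer (u : ℕ → Plane) (i : ℕ) : ℝ := hper i u / 2

theorem halfPer_monotone (u : ℕ → Plane) : Monotone (halfPer u) := fun _ _ h =>
  div_le_div_of_nonneg_right (hper_monotone u h) zero_le_two

theorem halfPer_nonneg (u : ℕ → Plane) (i : ℕ) : 0 ≤ halfPer u i :=
  div_nonneg (Finset.sum_nonneg fun _ _ => abs_nonneg _) zero_le_two

theorem abs_sub_eq_halfPer (u : ℕ → Plane) (i : ℕ) :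
    |u (i + 1) 0 - u i 0| = 2 * (halfPer u (i + 1) - halfPer u i) := by
  simp only [halfPer, hper_succ]
  ring

theorem height_le_height {n : ℕ} {u : ℕ → Plane} (hy : ∀ i < n, u i 1 ≤ u (i + 1) 1) (i j : ℕ)
    (hij : i ≤ j) (hj : j ≤ n) : u i 1 ≤ u j 1 := by
  induction j, hij using Nat.le_induction with
  | base => exact le_rfl
  | succ j _ ih => exact (ih (by omega)).trans (hy j (by omega))

/-- The spine of slope `c` at level `k`, as a height over each vertex. -/
def spineHeight (n : ℕ) (u : ℕ → Plane) (k : ℕ) (c : ℝ) (i : ℕ) : ℝ :=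
  envelope (halfPer u) (fun i => u i 1) n k c i

/-- The segment of the spine that ends over vertex `i + 1`. -/
def spineSegment (n : ℕ) (u : ℕ → Plane) (k : ℕ) (c : ℝ) (i : ℕ) : Plane × Plane :=
  (pt (u i 0) (spineHeight n u k c (i + 1) - c * (halfPer u (i + 1) - halfPer u i)),
    pt (u (i + 1) 0) (spineHeight n u k c (i + 1)))

/-- The vertical segment of length `l` hanging from vertex `i`. -/
def hangingSegment (u : ℕ → Plane) (l : ℝ) (i : ℕ) : Plane × Plane :=
  (pt (u i 0) (u i 1 - l), pt (u i 0) (u i 1))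

theorem norm_spineSegment_le {n k i : ℕ} {u : ℕ → Plane} {c : ℝ} (hc : 0 ≤ c) :
    ‖(spineSegment n u k c i).1 - (spineSegment n u k c i).2‖ ≤
      (c + 2) * (halfPer u (i + 1) - halfPer u i) := by
  have hd : 0 ≤ halfPer u (i + 1) - halfPer u i :=
    sub_nonneg.2 (halfPer_monotone u (Nat.le_succ i))
  rw [norm_sub_rev]
  refine (norm_le_abs_add_abs _).trans ?_
  simp only [spineSegment, PiLp.sub_apply, pt_zero, pt_one, sub_sub_cancel, abs_sub_eq_halfPer]
  rw [abs_of_nonneg (mul_nonneg hc hd)]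
  linarith

theorem norm_hangingSegment {u : ℕ → Plane} {l : ℝ} {i : ℕ} (hl : 0 ≤ l) :
    ‖(hangingSegment u l i).1 - (hangingSegment u l i).2‖ ≤ l := by
  refine (norm_le_abs_add_abs _).trans ?_
  simp [hangingSegment, abs_of_nonneg hl]

theorem climb_spine_step {E : Finset (Plane × Plane)} {n k i : ℕ} {u : ℕ → Plane} {c : ℝ}
    (hr : IsRectilinear n u) (hc : 0 < c)
    (hE : pathSet n u ⊆ segUnion E) (hi : i < n) (hs : spineSegment n u k c i ∈ E)
    (hb : blockIndex (halfPer u) k (i + 1) = blockIndex (halfPer u) k i) :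
    Climb E (pt (u i 0) (spineHeight n u k c i)) (pt (u (i + 1) 0) (spineHeight n u k c (i + 1)))
      (2 * (halfPer u (i + 1) - halfPer u i) / c) := by
  have hd : 0 ≤ halfPer u (i + 1) - halfPer u i :=
    sub_nonneg.2 (halfPer_monotone u (Nat.le_succ i))
  have hslant : Climb E (spineSegment n u k c i).1 (spineSegment n u k c i).2
      (2 * (halfPer u (i + 1) - halfPer u i) / c) := by
    refine Climb.of_segment (segment_subset_segUnion hs) ?_
    refine (norm_le_of_steep hc hd ?_ ?_).trans (le_of_eq ?_)
    · simp [spineSegment, abs_sub_eq_halfPer]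
    · simp [spineSegment]
    · simp [spineSegment]
  obtain ⟨hle, heq⟩ := envelope_step (t := halfPer u) (D := fun i => u i 1) (c := c) hi hb
  have hrise : Climb E (pt (u i 0) (spineHeight n u k c i)) (spineSegment n u k c i).1 0 := by
    rcases heq with heq | heq
    · simp only [spineSegment, spineHeight]
      rw [heq]
      exact Climb.rfl' _ _
    have htop : envelope (halfPer u) (fun i => u i 1) n k c (i + 1) ≤ u (i + 1) 1 :=
      envelope_le_self
    have hcd := mul_nonneg hc.le hd
    rcases hr i hi with hx | hx
    · refine Climb.of_vertical (a := u i 1) (b := u (i + 1) 1) ?_ heq.ge hle ?_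
      · refine Set.Subset.trans ?_ hE
        convert segment_subset_pathSet u hi using 2
        · simp
        · rw [hx]
          simp
      · simp only [spineHeight]
        linarith
    · have : envelope (halfPer u) (fun i => u i 1) n k c i
          = envelope (halfPer u) (fun i => u i 1) n k c (i + 1)
            - c * (halfPer u (i + 1) - halfPer u i) := by linarith
      simp only [spineSegment, spineHeight]
      rw [this]
      exact Climb.rfl' _ _
  exact (hrise.trans hslant).mono (zero_add _).le

theorem climb_spine {E : Finset (Plane × Plane)} {n k : ℕ} {u : ℕ → Plane} {c : ℝ}
    (hr : IsRectilinear n u) (hc : 0 < c) (hE : pathSet n u ⊆ segUnion E)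
    (hs : ∀ i < n, spineSegment n u k c i ∈ E) {i j : ℕ} (hij : i ≤ j) (hj : j ≤ n)
    (hb : blockIndex (halfPer u) k j = blockIndex (halfPer u) k i) :
    Climb E (pt (u i 0) (spineHeight n u k c i)) (pt (u j 0) (spineHeight n u k c j))
      (2 * (halfPer u j - halfPer u i) / c) := by
  induction j, hij using Nat.le_induction with
  | base => simpa using Climb.rfl' E _
  | succ j hij ih =>
    have hmono := blockIndex_mono (halfPer_monotone u) k
    have h1 := hmono hij
    have h2 : blockIndex (halfPer u) k j ≤ blockIndex (halfPer u) k (j + 1) :=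
      hmono (Nat.le_succ j)
    have hb1 : blockIndex (halfPer u) k j = blockIndex (halfPer u) k i := by omega
    refine ((ih (by omega) hb1).trans (climb_spine_step hr hc hE (by omega) (hs j (by omega))
      (by omega))).mono (le_of_eq ?_)
    ring

theorem climb_path {E : Finset (Plane × Plane)} {n : ℕ} {u : ℕ → Plane}
    (hy : ∀ i < n, u i 1 ≤ u (i + 1) 1) (hE : pathSet n u ⊆ segUnion E) {i j : ℕ} (hij : i ≤ j)
    (hj : j ≤ n) : Climb E (u i) (u j) (2 * (halfPer u j - halfPer u i)) := by
  induction j, hij using Nat.le_induction with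
  | base => simpa using Climb.rfl' E _
  | succ j hij ih =>
    refine ((ih (by omega)).trans (Climb.of_ascending
      ((segment_subset_pathSet u (by omega)).trans hE) (hy j (by omega)))).mono (le_of_eq ?_)
    rw [abs_sub_eq_halfPer]
    ring

/-- Slope of the spine at level `k`. -/
def levelSlope (h : ℝ) (k : ℕ) : ℝ := h / 2 * (3 / 4) ^ k

/-- Length of the vertical connectors at level `k`. -/
def levelDrop (h : ℝ) (k : ℕ) : ℝ := 2 * h * (3 / 8) ^ k

/-- The spines of levels up to `K`, and connectors at the starting points of all blocks. -/
def spineGraph (n : ℕ) (u : ℕ → Plane) (h : ℝ) (K : ℕ) : Finset (Plane × Plane) :=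
  ((Finset.range (K + 1)).sigma fun _ => Finset.range n).image
    (fun z => spineSegment n u z.1 (levelSlope h z.1) z.2) ∪
  ((Finset.range (K + 1)).sigma fun k => Finset.range (2 ^ k)).image
    (fun z => hangingSegment u (levelDrop h z.1) (blockStart (halfPer u) z.1 z.2))

theorem sum_geometric_le {r : ℝ} (h0 : 0 ≤ r) (h1 : r < 1) (m : ℕ) :
    ∑ k ∈ Finset.range m, r ^ k ≤ 1 / (1 - r) := by
  rw [le_div_iff₀ (by linarith), geom_sum_mul_neg]
  linarith [pow_nonneg h0 m]

theorem gweight_spineGraph_le {n K : ℕ} {u : ℕ → Plane} {h : ℝ} (hh : 0 < h)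
    (hu : hper n u ≤ 1) (hK : (K : ℝ) + 1 ≤ 2 * h) :
    gweight (spineGraph n u h K) ≤ 11 * h := by
  have hgeom : ∑ k ∈ Finset.range (K + 1), (3 / 4 : ℝ) ^ k ≤ 4 :=
    (sum_geometric_le (by norm_num) (by norm_num) _).trans (by norm_num)
  have hspine : gweight (((Finset.range (K + 1)).sigma fun _ => Finset.range n).image
      (fun z => spineSegment n u z.1 (levelSlope h z.1) z.2)) ≤ 3 * h := by
    refine (gweight_image_le _ _).trans ?_
    rw [Finset.sum_sigma]
    have hlevel : ∀ k ∈ Finset.range (K + 1), ∑ i ∈ Finset.range n,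
        ‖(spineSegment n u k (levelSlope h k) i).1 - (spineSegment n u k (levelSlope h k) i).2‖ ≤
        h / 4 * (3 / 4) ^ k + 1 := by
      intro k _
      have hc : 0 ≤ levelSlope h k := by unfold levelSlope; positivity
      refine (Finset.sum_le_sum fun i _ => norm_spineSegment_le hc).trans ?_
      rw [← Finset.mul_sum, Finset.sum_range_sub]
      have h1 : halfPer u n - halfPer u 0 ≤ 1 / 2 := by
        simp only [halfPer, hper, Finset.range_zero, Finset.sum_empty] at hu ⊢
        linarith
      refine (mul_le_mul_of_nonneg_left h1 (by linarith)).trans (le_of_eq ?_)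
      unfold levelSlope
      ring
    refine (Finset.sum_le_sum hlevel).trans ?_
    rw [Finset.sum_add_distrib, ← Finset.mul_sum]
    simp only [Finset.sum_const, Finset.card_range, nsmul_eq_mul, mul_one]
    push_cast
    nlinarith
  have hconn : gweight (((Finset.range (K + 1)).sigma fun k => Finset.range (2 ^ k)).image
      (fun z => hangingSegment u (levelDrop h z.1) (blockStart (halfPer u) z.1 z.2))) ≤ 8 * h := by
    refine (gweight_image_le _ _).trans ?_
    rw [Finset.sum_sigma]
    have hlevel : ∀ k ∈ Finset.range (K + 1), ∑ b ∈ Finset.range (2 ^ k),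
        ‖(hangingSegment u (levelDrop h k) (blockStart (halfPer u) k b)).1 -
          (hangingSegment u (levelDrop h k) (blockStart (halfPer u) k b)).2‖ ≤
        2 * h * (3 / 4) ^ k := by
      intro k _
      have hl : 0 ≤ levelDrop h k := by unfold levelDrop; positivity
      refine (Finset.sum_le_sum fun b _ => norm_hangingSegment hl).trans (le_of_eq ?_)
      simp only [Finset.sum_const, Finset.card_range, nsmul_eq_mul]
      unfold levelDrop
      rw [show (3 / 4 : ℝ) = 2 * (3 / 8) by norm_num, mul_pow]
      push_cast
      ring
    refine (Finset.sum_le_sum hlevel).trans ?_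
    rw [← Finset.mul_sum]
    nlinarith
  refine (gweight_union_le _ _).trans ?_
  linarith

theorem climb_spineGraph {n K : ℕ} {u : ℕ → Plane} {h : ℝ} (hh : 0 < h)
    (hr : IsRectilinear n u) (hy : ∀ i < n, u i 1 ≤ u (i + 1) 1) (hu : hper n u ≤ 1)
    (hK : h ≤ 2 ^ K) {i : ℕ} (hi : i ≤ n) :
    Climb (pathEdges n u ∪ spineGraph n u h K) (pt (u 0 0) (u 0 1 - h / 2)) (u i) (14 / h) := by
  set E := pathEdges n u ∪ spineGraph n u h K with hEdef
  have hE : pathSet n u ⊆ segUnion E := by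
    rw [hEdef, segUnion_union, segUnion_pathEdges]
    exact Set.subset_union_left
  have hspine : ∀ k ≤ K, ∀ i < n, spineSegment n u k (levelSlope h k) i ∈ E := by
    intro k hk i hi
    refine Finset.mem_union_right _ (Finset.mem_union_left _ (Finset.mem_image.2 ⟨⟨k, i⟩, ?_, rfl⟩))
    simp [hi, Nat.lt_succ_of_le hk]
  set s : ℕ → ℕ := fun k => blockStart (halfPer u) k (blockIndex (halfPer u) k i) with hs
  have hsi : ∀ k, s k ≤ i := fun k => blockStart_le rfl
  have hsb : ∀ k, blockIndex (halfPer u) k (s k) = blockIndex (halfPer u) k i := fun k =>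
    blockIndex_blockStart _ _ _
  have hlt : halfPer u i < 1 := by
    have := hper_monotone u hi
    simp only [halfPer] at this ⊢
    linarith
  have hconn : ∀ k ≤ K, segment ℝ (pt (u (s k) 0) (u (s k) 1 - levelDrop h k))
      (pt (u (s k) 0) (u (s k) 1)) ⊆ segUnion E := by
    intro k hk
    refine segment_subset_segUnion (e := hangingSegment u (levelDrop h k) (s k))
      (Finset.mem_union_right _ (Finset.mem_union_right _
        (Finset.mem_image.2 ⟨⟨k, blockIndex (halfPer u) k i⟩, ?_, rfl⟩)))
    simp [Nat.lt_succ_of_le hk, blockIndex_lt (halfPer_nonneg u) hlt]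
  have hslope : ∀ k, 0 < levelSlope h k := fun k => by unfold levelSlope; positivity
  have hlow : ∀ k m, m ≤ n →
      u m 1 - h / 2 * (3 / 8) ^ k ≤ spineHeight n u k (levelSlope h k) m := by
    intro k m hm
    refine le_trans (le_of_eq ?_)
      (le_envelope (halfPer_nonneg u) (height_le_height hy) (hslope k).le hm)
    rw [levelSlope, mul_assoc, ← mul_pow]
    norm_num
  have hmain : ∀ k ≤ K, Climb E (pt (u 0 0) (u 0 1 - h / 2))
      (pt (u (s k) 0) (spineHeight n u k (levelSlope h k) (s k)))
      (∑ l ∈ Finset.range k, 4 / h * (2 / 3) ^ l) := by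
    intro k
    induction k with
    | zero =>
      intro _
      have h0 : s 0 = 0 := by
        refine Nat.le_zero.1 (blockStart_le ?_)
        have h1 := blockIndex_lt (k := 0) (halfPer_nonneg u) hlt
        have h2 := blockIndex_mono (halfPer_monotone u) 0 (Nat.zero_le i)
        omega
      have h1 := hconn 0 (Nat.zero_le K)
      have h2 := hlow 0 0 (Nat.zero_le n)
      rw [h0] at h1 ⊢
      simp only [levelDrop, pow_zero, mul_one] at h1 h2
      simpa using Climb.of_vertical h1 (by linarith) h2 envelope_le_self
    | succ k ih =>
      intro hk
      have hsn : s (k + 1) ≤ n := (hsi _).trans hi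
      have hblock : blockIndex (halfPer u) k (s (k + 1)) = blockIndex (halfPer u) k (s k) :=
        (blockIndex_eq_of_succ (hsb (k + 1))).trans (hsb k).symm
      have h1 := climb_spine hr (hslope k) hE (hspine k (by omega)) (blockStart_le_succ _ k i)
        hsn hblock
      have hle : levelSlope h (k + 1) ≤ levelSlope h k := by
        have : 0 < h * (3 / 4) ^ k := by positivity
        simp only [levelSlope, pow_succ]
        linarith
      have h2 : Climb E (pt (u (s (k + 1)) 0) (spineHeight n u k (levelSlope h k) (s (k + 1))))
          (pt (u (s (k + 1)) 0)
            (spineHeight n u (k + 1) (levelSlope h (k + 1)) (s (k + 1)))) 0 := by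
        refine Climb.of_vertical (hconn (k + 1) hk) ((le_trans ?_ (hlow k _ hsn)))
          (envelope_le_succ (halfPer_monotone u) hle hsn) envelope_le_self
        have : 0 < h * (3 / 8) ^ k := by positivity
        simp only [levelDrop, pow_succ]
        linarith
      refine ((ih (by omega)).trans (h1.trans h2)).mono ?_
      rw [Finset.sum_range_succ, add_zero]
      refine add_le_add le_rfl ?_
      have h3 := sub_le_of_blockIndex_eq (halfPer_nonneg u) hblock.symm
      rw [div_le_iff₀ (hslope k)]
      refine (mul_le_mul_of_nonneg_left h3 zero_le_two).trans (le_of_eq ?_)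
      have h4 : (1 / 2 : ℝ) ^ k = (2 / 3) ^ k * (3 / 4) ^ k := by
        rw [← mul_pow]
        norm_num
      rw [h4, levelSlope]
      field_simp
      norm_num
  have hsK : s K ≤ n := (hsi K).trans hi
  have hend : Climb E (pt (u (s K) 0) (spineHeight n u K (levelSlope h K) (s K))) (u (s K)) 0 := by
    have : Climb E (pt (u (s K) 0) (spineHeight n u K (levelSlope h K) (s K)))
        (pt (u (s K) 0) (u (s K) 1)) 0 := by
      refine Climb.of_vertical (hconn K le_rfl) (le_trans ?_ (hlow K _ hsK)) envelope_le_self le_rfl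
      have : 0 < h * (3 / 8) ^ K := by positivity
      simp only [levelDrop]
      linarith
    simpa using this
  refine ((hmain K le_rfl).trans (hend.trans (climb_path hy hE (hsi K) hi))).mono ?_
  have h1 : ∑ l ∈ Finset.range K, 4 / h * (2 / 3 : ℝ) ^ l ≤ 12 / h := by
    rw [← Finset.mul_sum]
    refine (mul_le_mul_of_nonneg_left
      (sum_geometric_le (by norm_num) (by norm_num) K) (by positivity)).trans (le_of_eq ?_)
    ring
  have h2 : halfPer u i - halfPer u (s K) ≤ 1 / h := by
    refine (sub_le_of_blockIndex_eq (halfPer_nonneg u) (hsb K)).trans ?_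
    rw [one_div_pow]
    exact one_div_le_one_div_of_le hh hK
  have h3 : 14 / h = 12 / h + 2 * (1 / h) := by ring
  linarith

/-- Ascending rectilinear paths with short horizontal edges. -/
theorem exists_climb_of_short_edges {n : ℕ} {u : ℕ → Plane} {h : ℝ} (hh : 1 ≤ h)
    (hr : IsRectilinear n u) (hy : ∀ i < n, u i 1 ≤ u (i + 1) 1) (hu : hper n u ≤ 1)
    (hshort : ∀ i < n, |u (i + 1) 0 - u i 0| ≤ 1 / h) :
    ∃ Ex : Finset (Plane × Plane), gweight Ex ≤ 11 * h ∧ ∀ a ∈ pathSet n u,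
      Climb (pathEdges n u ∪ Ex) (pt (u 0 0) (u 0 1 - h / 2)) a (15 / h) := by
  obtain ⟨m, hm1, hm2⟩ := exists_nat_pow_near hh one_lt_two
  have hcard : ((m + 1 : ℕ) : ℝ) + 1 ≤ 2 * h := by
    have h1 : m + 1 + 1 ≤ 2 ^ (m + 1) := Nat.lt_two_pow_self
    have h2 : ((m + 1 : ℕ) : ℝ) + 1 ≤ 2 ^ (m + 1) := by exact_mod_cast h1
    rw [pow_succ] at h2
    linarith
  refine ⟨spineGraph n u h (m + 1), gweight_spineGraph_le (by linarith) hu hcard, fun a ha => ?_⟩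
  simp only [pathSet, Set.mem_iUnion, Finset.mem_range] at ha
  obtain ⟨i, hi, ha⟩ := ha
  have hE : pathSet n u ⊆ segUnion (pathEdges n u ∪ spineGraph n u h (m + 1)) := by
    rw [segUnion_union, segUnion_pathEdges]
    exact Set.subset_union_left
  have hsub : segment ℝ (u i) a ⊆ segment ℝ (u i) (u (i + 1)) :=
    (convex_segment _ _).segment_subset (left_mem_segment ℝ _ _) ha
  obtain ⟨θ, hθ, rfl⟩ := segment_eq_image' ℝ (u i) (u (i + 1)) ▸ ha
  have hlast : Climb (pathEdges n u ∪ spineGraph n u h (m + 1)) (u i)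
      (u i + θ • (u (i + 1) - u i)) (1 / h) := by
    refine (Climb.of_ascending (hsub.trans ((segment_subset_pathSet u hi).trans hE)) ?_).mono ?_
    · simpa using mul_nonneg hθ.1 (sub_nonneg.2 (hy i hi))
    · simp only [PiLp.add_apply, PiLp.smul_apply, PiLp.sub_apply, smul_eq_mul,
        add_sub_cancel_left, abs_mul, abs_of_nonneg hθ.1]
      exact (mul_le_of_le_one_left (abs_nonneg _) hθ.2).trans (hshort i hi)
  refine ((climb_spineGraph (by linarith) hr hy hu hm2.le hi.le).trans hlast).mono (le_of_eq ?_)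
  ring

/-! ### Subdivision and orientation -/

/-- Every edge of the path is divided into `m` equal parts. -/
def subdivide (m : ℕ) (u : ℕ → Plane) (j : ℕ) : Plane :=
  u (j / m) + ((j % m : ℕ) / (m : ℝ)) • (u (j / m + 1) - u (j / m))

section Subdivide

variable {m n : ℕ} (u : ℕ → Plane)

theorem subdivide_mul_add (hm : 0 < m) (q : ℕ) {r : ℕ} (hr : r ≤ m) :
    subdivide m u (q * m + r) = u q + (r / (m : ℝ)) • (u (q + 1) - u q) := by
  rcases hr.lt_or_eq with h | rfl
  · have h1 : (q * m + r) / m = q := by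
      rw [add_comm, Nat.add_mul_div_right _ _ hm, Nat.div_eq_of_lt h, zero_add]
    have h2 : (q * m + r) % m = r := by
      rw [add_comm, Nat.add_mul_mod_self_right, Nat.mod_eq_of_lt h]
    rw [subdivide, h1, h2]
  · rw [← Nat.succ_mul, subdivide, Nat.mul_div_cancel _ hm, Nat.mul_mod_left, div_self (by positivity)]
    simp

theorem subdivide_succ (hm : 0 < m) (j : ℕ) : subdivide m u (j + 1) =
    subdivide m u j + (1 / (m : ℝ)) • (u (j / m + 1) - u (j / m)) := by
  have h1 : j + 1 = j / m * m + (j % m + 1) := by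
    rw [← add_assoc, Nat.div_add_mod']
  rw [h1, subdivide_mul_add u hm _ (Nat.mod_lt j hm), subdivide]
  push_cast
  module

theorem subdivide_succ_apply (hm : 0 < m) (j : ℕ) (d : Fin 2) : subdivide m u (j + 1) d =
    subdivide m u j d + 1 / m * (u (j / m + 1) d - u (j / m) d) := by
  simp [subdivide_succ u hm j]

theorem subdivide_mem_segment (hm : 0 < m) (q : ℕ) {r : ℕ} (hr : r ≤ m) :
    subdivide m u (q * m + r) ∈ segment ℝ (u q) (u (q + 1)) := by
  rw [segment_eq_image', subdivide_mul_add u hm q hr]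
  refine ⟨r / m, ⟨by positivity, div_le_one_of_le₀ ?_ (by positivity)⟩, rfl⟩
  exact_mod_cast hr

theorem pathSet_subdivide_subset (hm : 0 < m) :
    pathSet (n * m) (subdivide m u) ⊆ pathSet n u := by
  intro a ha
  simp only [pathSet, Set.mem_iUnion, Finset.mem_range] at ha
  obtain ⟨j, hj, ha⟩ := ha
  have h1 := subdivide_mem_segment u hm (j / m) (Nat.mod_lt j hm).le
  have h2 := subdivide_mem_segment u hm (j / m) (Nat.succ_le_of_lt (Nat.mod_lt j hm))
  rw [Nat.succ_eq_add_one, ← add_assoc] at h2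
  rw [Nat.div_add_mod'] at h1 h2
  exact segment_subset_pathSet u (Nat.div_lt_of_lt_mul (by rwa [mul_comm]))
    ((convex_segment _ _).segment_subset h1 h2 ha)

theorem pathSet_subset_subdivide (hm : 0 < m) :
    pathSet n u ⊆ pathSet (n * m) (subdivide m u) := by
  intro a ha
  simp only [pathSet, Set.mem_iUnion, Finset.mem_range] at ha
  obtain ⟨q, hq, ha⟩ := ha
  obtain ⟨θ, hθ, rfl⟩ := segment_eq_image' ℝ (u q) (u (q + 1)) ▸ ha
  have hm' : (0 : ℝ) < m := by exact_mod_cast hm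
  obtain ⟨r, hr, h1, h2⟩ : ∃ r < m, (r : ℝ) ≤ θ * m ∧ θ * m ≤ r + 1 := by
    rcases hθ.2.lt_or_eq with h | rfl
    · exact ⟨⌊θ * m⌋₊, (Nat.floor_lt (mul_nonneg hθ.1 hm'.le)).2 (by nlinarith),
        Nat.floor_le (mul_nonneg hθ.1 hm'.le), (Nat.lt_floor_add_one _).le⟩
    · obtain ⟨r, rfl⟩ := Nat.exists_eq_succ_of_ne_zero hm.ne'
      exact ⟨r, Nat.lt_succ_self r, by simp, by simp⟩
  refine segment_subset_pathSet (subdivide m u) (i := q * m + r) ?_ ?_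
  · calc q * m + r < q * m + m := by omega
      _ = (q + 1) * m := by ring
      _ ≤ n * m := Nat.mul_le_mul_right m hq
  · rw [segment_eq_image', add_assoc, subdivide_mul_add u hm q hr.le,
      subdivide_mul_add u hm q (Nat.succ_le_of_lt hr)]
    refine ⟨θ * m - r, ⟨by linarith, by linarith⟩, ?_⟩
    have h3 : θ = r / m + (θ * m - r) * ((r + 1 : ℕ) / m - r / m) := by
      push_cast
      field_simp
      ring
    beta_reduce
    conv_rhs => rw [h3]
    module

theorem hper_subdivide (hm : 0 < m) : hper (n * m) (subdivide m u) = hper n u := by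
  have hm' : (0 : ℝ) < m := by exact_mod_cast hm
  induction n with
  | zero => simp [hper]
  | succ n ih =>
    rw [hper_succ, ← ih, Nat.succ_mul]
    unfold hper
    rw [Finset.sum_range_add]
    congr 1
    have h : ∀ r ∈ Finset.range m, |subdivide m u (n * m + r + 1) 0 - subdivide m u (n * m + r) 0|
        = 1 / m * |u (n + 1) 0 - u n 0| := by
      intro r hr
      have hdiv : (n * m + r) / m = n := by
        rw [add_comm, Nat.add_mul_div_right _ _ hm, Nat.div_eq_of_lt (Finset.mem_range.1 hr),
          zero_add]
      rw [subdivide_succ_apply u hm, hdiv, add_sub_cancel_left, abs_mul, abs_of_pos (by positivity)]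
    rw [Finset.sum_congr rfl h]
    simp only [Finset.sum_const, Finset.card_range, nsmul_eq_mul]
    field_simp

end Subdivide

/-- Shallow-light connections to an ascending rectilinear path. -/
theorem exists_climb_of_ascending {n : ℕ} {u : ℕ → Plane} {h : ℝ} (hh : 1 ≤ h)
    (hr : IsRectilinear n u) (hy : ∀ i < n, u i 1 ≤ u (i + 1) 1) (hu : hper n u ≤ 1) :
    ∃ Ex : Finset (Plane × Plane), gweight Ex ≤ 11 * h ∧ ∀ a ∈ pathSet n u,
      Climb (pathEdges n u ∪ Ex) (pt (u 0 0) (u 0 1 - h / 2)) a (15 / h) := by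
  obtain ⟨m, hm⟩ := exists_nat_ge h
  have hm' : (0 : ℝ) < m := by linarith
  have hm0 : 0 < m := by exact_mod_cast hm'
  have hq : ∀ j < n * m, j / m < n := fun j hj => Nat.div_lt_of_lt_mul (by rwa [mul_comm])
  have hzero : subdivide m u 0 = u 0 := by simp [subdivide]
  have hr' : IsRectilinear (n * m) (subdivide m u) := by
    intro j hj
    rw [subdivide_succ_apply u hm0, subdivide_succ_apply u hm0]
    rcases hr _ (hq j hj) with h1 | h1
    · left
      simp [h1]
    · right
      simp [h1]
  have hy' : ∀ j < n * m, subdivide m u j 1 ≤ subdivide m u (j + 1) 1 := by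
    intro j hj
    rw [subdivide_succ_apply u hm0]
    exact le_add_of_nonneg_right (mul_nonneg (by positivity) (sub_nonneg.2 (hy _ (hq j hj))))
  have hshort : ∀ j < n * m, |subdivide m u (j + 1) 0 - subdivide m u j 0| ≤ 1 / h := by
    intro j hj
    rw [subdivide_succ_apply u hm0, add_sub_cancel_left, abs_mul, abs_of_pos (by positivity)]
    have h1 : |u (j / m + 1) 0 - u (j / m) 0| ≤ 1 := by
      refine le_trans ?_ hu
      exact Finset.single_le_sum (f := fun i => |u (i + 1) 0 - u i 0|)
        (fun _ _ => abs_nonneg _) (Finset.mem_range.2 (hq j hj))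
    refine (mul_le_of_le_one_right (by positivity) h1).trans ?_
    exact one_div_le_one_div_of_le (by linarith) hm
  obtain ⟨Ex, hEx, hc⟩ :=
    exists_climb_of_short_edges hh hr' hy' ((hper_subdivide u hm0).trans_le hu) hshort
  refine ⟨Ex, hEx, fun a ha => ?_⟩
  have := hc a (pathSet_subset_subdivide u hm0 ha)
  rw [hzero] at this
  refine HasPath.mono this ?_ le_rfl
  rw [segUnion_union, segUnion_union, segUnion_pathEdges, segUnion_pathEdges]
  exact Set.union_subset_union_left _ (pathSet_subdivide_subset u hm0)

theorem pathSet_reverse (n : ℕ) (u : ℕ → Plane) :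
    pathSet n (fun i => u (n - i)) = pathSet n u := by
  have hsub : ∀ v : ℕ → Plane, pathSet n (fun i => v (n - i)) ⊆ pathSet n v := by
    intro v a ha
    simp only [pathSet, Set.mem_iUnion, Finset.mem_range] at ha
    obtain ⟨i, hi, ha⟩ := ha
    rw [show n - i = n - (i + 1) + 1 by omega, segment_symm] at ha
    exact segment_subset_pathSet v (by omega) ha
  refine (hsub u).antisymm fun a ha => hsub (fun i => u (n - i)) ?_
  simp only [pathSet, Set.mem_iUnion, Finset.mem_range] at ha ⊢
  obtain ⟨i, hi, ha⟩ := ha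
  refine ⟨i, hi, ?_⟩
  rwa [show n - (n - i) = i by omega, show n - (n - (i + 1)) = i + 1 by omega]

theorem hper_reverse (n : ℕ) (u : ℕ → Plane) : hper n (fun i => u (n - i)) = hper n u := by
  unfold hper
  rw [← Finset.sum_range_reflect]
  refine Finset.sum_congr rfl fun i hi => ?_
  have hi := Finset.mem_range.1 hi
  beta_reduce
  rw [abs_sub_comm, show n - (n - 1 - i) = i + 1 by omega, show n - (n - 1 - i + 1) = i by omega]

theorem height_zero_le {n : ℕ} {u : ℕ → Plane} (hy : ∀ i < n, u i 1 ≤ u (i + 1) 1)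
    {p : Plane} (hp : p ∈ pathSet n u) : u 0 1 ≤ p 1 := by
  simp only [pathSet, Set.mem_iUnion, Finset.mem_range] at hp
  obtain ⟨i, hi, hp⟩ := hp
  obtain ⟨θ, hθ, rfl⟩ := segment_eq_image' ℝ (u i) (u (i + 1)) ▸ hp
  have h1 := height_le_height hy 0 i (Nat.zero_le i) hi.le
  have h2 := mul_nonneg hθ.1 (sub_nonneg.2 (hy i hi))
  simp only [PiLp.add_apply, PiLp.smul_apply, PiLp.sub_apply, smul_eq_mul]
  linarith

/-- Shallow-light connections from below the lowest point to a monotone rectilinear path. -/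
theorem exists_climb_of_isYMonotone {n : ℕ} {u : ℕ → Plane} {h : ℝ} (hh : 1 ≤ h)
    (hr : IsRectilinear n u) (hy : IsYMonotone n u) (hu : hper n u ≤ 1)
    {z : ℝ} (hz : ∀ p ∈ pathSet n u, z ≤ p 1) (hz' : ∃ p ∈ pathSet n u, p 1 = z) :
    ∃ q ∈ pathSet n u, ∃ Ex : Finset (Plane × Plane), gweight Ex ≤ 11 * h ∧
      ∀ a ∈ pathSet n u, Climb (pathEdges n u ∪ Ex) (pt (q 0) (z - h / 2)) a (15 / h) := by
  obtain ⟨p, hp, hpz⟩ := hz'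
  have hn : 0 < n := by
    rcases Nat.eq_zero_or_pos n with rfl | hn
    · simp [pathSet] at hp
    · exact hn
  rcases hy with hy | hy
  · obtain ⟨Ex, hEx, hc⟩ := exists_climb_of_ascending hh hr hy hu
    have h0 : u 0 1 = z :=
      ((height_zero_le hy hp).trans hpz.le).antisymm (hz _ (vertex_mem_pathSet u hn (Nat.zero_le n)))
    exact ⟨u 0, vertex_mem_pathSet u hn (Nat.zero_le n), Ex, hEx, h0 ▸ hc⟩
  · set v : ℕ → Plane := fun i => u (n - i) with hv
    have hset : pathSet n v = pathSet n u := pathSet_reverse n u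
    have hsucc : ∀ i < n, n - i = n - (i + 1) + 1 := fun i hi => by omega
    have hvy : ∀ i < n, v i 1 ≤ v (i + 1) 1 := by
      intro i hi
      have := hy (n - (i + 1)) (by omega)
      rwa [← hsucc i hi] at this
    have hvr : IsRectilinear n v := by
      intro i hi
      have := hr (n - (i + 1)) (by omega)
      rw [← hsucc i hi] at this
      exact this.imp Eq.symm Eq.symm
    obtain ⟨Ex, hEx, hc⟩ := exists_climb_of_ascending hh hvr hvy ((hper_reverse n u).trans_le hu)
    have hmem : v 0 ∈ pathSet n u := vertex_mem_pathSet u hn (Nat.sub_le n 0)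
    have h0 : v 0 1 = z :=
      ((height_zero_le hvy (hset ▸ hp)).trans hpz.le).antisymm (hz _ hmem)
    refine ⟨v 0, hmem, Ex, hEx, fun a ha => ?_⟩
    have := hc a (hset ▸ ha)
    rw [h0] at this
    refine HasPath.mono this ?_ le_rfl
    rw [segUnion_union, segUnion_union, segUnion_pathEdges, segUnion_pathEdges, hset]

theorem neg_mem_segment_iff {p q z : Plane} :
    -z ∈ segment ℝ (-p) (-q) ↔ z ∈ segment ℝ p q := by
  have hsub : ∀ {p q z : Plane}, z ∈ segment ℝ p q → -z ∈ segment ℝ (-p) (-q) := by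
    rintro p q z ⟨a, b, ha, hb, hab, rfl⟩
    exact ⟨a, b, ha, hb, hab, by module⟩
  exact ⟨fun hz => by simpa using hsub hz, hsub⟩

theorem neg_mem_pathSet_iff {n : ℕ} {u : ℕ → Plane} {z : Plane} :
    -z ∈ pathSet n (fun i => -u i) ↔ z ∈ pathSet n u := by
  simp only [pathSet, Set.mem_iUnion, neg_mem_segment_iff]

/-- The reflection of a geometric graph in the origin. -/
def negGraph (E : Finset (Plane × Plane)) : Finset (Plane × Plane) :=
  E.image fun e => (-e.1, -e.2)

theorem neg_mem_segUnion_negGraph {E : Finset (Plane × Plane)} {z : Plane}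
    (hz : z ∈ segUnion E) : -z ∈ segUnion (negGraph E) := by
  simp only [segUnion, Set.mem_iUnion] at hz
  obtain ⟨e, he, hz⟩ := hz
  have he' : (-e.1, -e.2) ∈ negGraph E := Finset.mem_image.2 ⟨e, he, rfl⟩
  exact segment_subset_segUnion he' (neg_mem_segment_iff.2 hz)

theorem gweight_negGraph_le (E : Finset (Plane × Plane)) : gweight (negGraph E) ≤ gweight E := by
  refine (gweight_image_le _ _).trans (le_of_eq (Finset.sum_congr rfl fun e _ => ?_))
  rw [← norm_neg]
  congr 1
  module

/-- Shallow-light connections from above the highest point to a monotone rectilinear path. -/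
theorem exists_descent_of_isYMonotone {n : ℕ} {u : ℕ → Plane} {h : ℝ} (hh : 1 ≤ h)
    (hr : IsRectilinear n u) (hy : IsYMonotone n u) (hu : hper n u ≤ 1)
    {z : ℝ} (hz : ∀ p ∈ pathSet n u, p 1 ≤ z) (hz' : ∃ p ∈ pathSet n u, p 1 = z) :
    ∃ q ∈ pathSet n u, ∃ Ex : Finset (Plane × Plane), gweight Ex ≤ 11 * h ∧
      ∀ b ∈ pathSet n u,
        HasPath (pathEdges n u ∪ Ex) (pt (q 0) (z + h / 2)) b (z + h / 2 - b 1 + 15 / h) := by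
  have hmem : ∀ p, p ∈ pathSet n (fun i => -u i) → -p ∈ pathSet n u := fun p hp =>
    neg_mem_pathSet_iff.1 (by simpa using hp)
  obtain ⟨q, hq, Ex, hEx, hc⟩ := exists_climb_of_isYMonotone (u := fun i => -u i) (z := -z) hh
    (fun i hi => by simpa using hr i hi)
    (hy.symm.imp (fun hy i hi => by simpa using hy i hi) fun hy i hi => by simpa using hy i hi)
    (le_of_eq_of_le (Finset.sum_congr rfl fun i _ => by
      rw [abs_sub_comm]
      congr 1
      simp
      ring) hu)
    (fun p hp => by simpa using neg_le_neg (hz _ (hmem p hp)))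
    (by
      obtain ⟨p, hp, hpz⟩ := hz'
      exact ⟨-p, neg_mem_pathSet_iff.2 hp, by simp [hpz]⟩)
  refine ⟨-q, hmem q hq, negGraph Ex, (gweight_negGraph_le Ex).trans hEx, fun b hb => ?_⟩
  have h1 := HasPath.neg (F := pathEdges n u ∪ negGraph Ex) (hc (-b) (neg_mem_pathSet_iff.2 hb)) ?_
  · rw [neg_neg, show -pt (q 0) (-z - h / 2) = pt ((-q) 0) (z + h / 2) from
      plane_ext (by simp) (by simp; ring)] at h1
    refine h1.mono subset_rfl (le_of_eq ?_)
    simp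
    ring
  · intro w hw
    rw [segUnion_union, segUnion_pathEdges] at hw ⊢
    exact hw.imp (hmem w) neg_mem_segUnion_negGraph

-- **Statement 12.** (Combination of two SLTs.) There is an absolute constant `C > 0`
-- such that for every `ε ∈ (0,1]`, every axis-parallel rectangle
-- `R = [x₀, x₀+1] × [y₀, y₀+2ε^{-1/2}]`, and all `y`-monotone rectilinear paths `L₁`
-- (above `R`, lowest point on the top side of `R`) and `L₂` (below `R`, highest point on
-- the bottom side of `R`) in the vertical strip of `R`, each with horizontal edges of
-- total length at most `1`, there is a geometric graph comprised of the edges of `L₁`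
-- and `L₂` and additional segments of total weight at most `C·ε^{-1/2}` containing, for
-- all `a ∈ L₁` and `b ∈ L₂`, an `ab`-path of weight at most `(1 + C·ε)·‖a − b‖`.
theorem slt_combination_exists :
    ∃ C : ℝ, 0 < C ∧
      ∀ ε : ℝ, 0 < ε → ε ≤ 1 →
      ∀ x₀ y₀ : ℝ,
      ∀ (n₁ : ℕ) (u₁ : ℕ → Plane) (n₂ : ℕ) (u₂ : ℕ → Plane),
        IsRectilinear n₁ u₁ → IsYMonotone n₁ u₁ →
        IsRectilinear n₂ u₂ → IsYMonotone n₂ u₂ →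
        (∀ p ∈ pathSet n₁ u₁, x₀ ≤ p 0 ∧ p 0 ≤ x₀ + 1) →
        (∀ p ∈ pathSet n₂ u₂, x₀ ≤ p 0 ∧ p 0 ≤ x₀ + 1) →
        hper n₁ u₁ ≤ 1 → hper n₂ u₂ ≤ 1 →
        (∀ p ∈ pathSet n₁ u₁, y₀ + 2 * (Real.sqrt ε)⁻¹ ≤ p 1) →
        (∃ p ∈ pathSet n₁ u₁, p 1 = y₀ + 2 * (Real.sqrt ε)⁻¹) →
        (∀ p ∈ pathSet n₂ u₂, p 1 ≤ y₀) →
        (∃ p ∈ pathSet n₂ u₂, p 1 = y₀) →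
        ∃ Ex : Finset (Plane × Plane),
          gweight Ex ≤ C * (Real.sqrt ε)⁻¹ ∧
          ∀ a ∈ pathSet n₁ u₁, ∀ b ∈ pathSet n₂ u₂,
            HasPath (pathEdges n₁ u₁ ∪ pathEdges n₂ u₂ ∪ Ex) a b
              ((1 + C * ε) * ‖a - b‖) := by
  refine ⟨32, by norm_num, ?_⟩
  intro ε hε hε1 x₀ y₀ n₁ u₁ n₂ u₂ hr₁ hm₁ hr₂ hm₂ hx₁ hx₂ hh₁ hh₂ hlow hlow' hhigh hhigh'
  set h : ℝ := (√ε)⁻¹ with hdef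
  have hsqrt : 0 < √ε := Real.sqrt_pos.2 hε
  have h1 : 1 ≤ h := (one_le_inv₀ hsqrt).2 (Real.sqrt_le_one.2 hε1)
  have hpos : 0 < h := by linarith
  have hεh : 1 / h = ε * h := by
    rw [hdef, one_div, inv_inv, ← div_eq_mul_inv, eq_div_iff hsqrt.ne', Real.mul_self_sqrt hε.le]
  obtain ⟨q₁, hq₁, E₁, hE₁, hc₁⟩ := exists_climb_of_isYMonotone h1 hr₁ hm₁ hh₁ hlow hlow'
  obtain ⟨q₂, hq₂, E₂, hE₂, hc₂⟩ := exists_descent_of_isYMonotone h1 hr₂ hm₂ hh₂ hhigh hhigh'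
  set A := pt (q₁ 0) (y₀ + 2 * h - h / 2) with hA
  set B := pt (q₂ 0) (y₀ + h / 2) with hB
  have hbridge : ‖A - B‖ ≤ h + 2 / h := by
    have := norm_le_of_steep (p := A - B) (c := h) (d := 1) hpos zero_le_one ?_ ?_
    · simpa using this
    · have := hx₁ q₁ hq₁
      have := hx₂ q₂ hq₂
      simp only [hA, hB, PiLp.sub_apply, pt_zero]
      rw [abs_le]
      constructor <;> linarith
    · simp only [hA, hB, PiLp.sub_apply, pt_one]
      ring
  have h2 : 2 / h ≤ 2 := div_le_self zero_le_two h1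
  refine ⟨E₁ ∪ E₂ ∪ {(A, B)}, ?_, fun a ha b hb => ?_⟩
  · have h3 := gweight_union_le (E₁ ∪ E₂) {(A, B)}
    have h4 := gweight_union_le E₁ E₂
    have h5 : gweight {(A, B)} = ‖A - B‖ := Finset.sum_singleton _ _
    linarith
  · set E := pathEdges n₁ u₁ ∪ pathEdges n₂ u₂ ∪ (E₁ ∪ E₂ ∪ {(A, B)}) with hE
    have hup : HasPath E A a (a 1 - A 1 + 15 / h) := by
      refine HasPath.mono (hc₁ a ha) ?_ le_rfl
      simp only [hE, segUnion_union]
      grind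
    have hdown : HasPath E B b (y₀ + h / 2 - b 1 + 15 / h) := by
      refine (hc₂ b hb).mono ?_ le_rfl
      simp only [hE, segUnion_union]
      grind
    have hmid : HasPath E A B ‖B - A‖ :=
      HasPath.of_segment (segment_subset_segUnion (e := (A, B)) (by simp [hE]))
    refine ((hup.symm.trans hmid).trans hdown).mono subset_rfl ?_
    have h3 : (a - b) 1 ≤ ‖a - b‖ := apply_one_le_norm _
    have h4 := hlow a ha
    have h5 := hhigh b hb
    rw [norm_sub_rev, hA, pt_one]
    rw [PiLp.sub_apply] at h3
    have h6 : ε * (2 * h) ≤ ε * ‖a - b‖ := mul_le_mul_of_nonneg_left (by linarith) hε.le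
    have h7 : 15 / h = 15 * (ε * h) := by rw [← hεh]; ring
    have h8 : 2 / h = 2 * (ε * h) := by rw [← hεh]; ring
    rw [h7]
    rw [h8] at hbridge
    have h9 : 0 ≤ ε * ‖a - b‖ := by positivity
    linarith

end
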